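/- Let φ_o, φ_m, v : ℝ³ → ℝ³ be continuously differentiable, let f_o : ℝ³ → ℝ and g_o : ℝ³ → ℝ³ be continuous, and let Ω ⊂ ℝ³ be a compact measurable set. Define SSD(t) = ∫_Ω [½(det∇((φ_m + t·v) ∘ φ_o)(x) − f_o(x))² + ½‖∇×((φ_m + t·v) ∘ φ_o)(x) − g_o(x)‖²] dx. Then SSD is differentiable at t = 0 with derivative SSD'(0) = ∫_Ω [P(x) · trace(adjugate(∇φ_m(φ_o(x))) · ∇v(φ_o(x))) · det∇φ_o(x) + Q(x)·(∇×(v ∘ φ_o))(x)] dx, where P(x) = det∇(φ_m ∘ φ_o)(x) − f_o(x) and Q(x) = ∇×(φ_m ∘ φ_o)(x) − g_o(x). -/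

import Mathlib

noncomputable section

open MeasureTheory RealInnerProductSpace

abbrev E3 := EuclideanSpace ℝ (Fin 3)

/-- `i`-th partial derivative of a scalar function on ℝ³. -/
def pd (i : Fin 3) (f : E3 → ℝ) (x : E3) : ℝ :=
  fderiv ℝ f x (EuclideanSpace.single i 1)

/-- Curl of a vector field on ℝ³. -/
def curlE (F : E3 → E3) (x : E3) : E3 :=
  (WithLp.equiv 2 (Fin 3 → ℝ)).symm
    ![pd 1 (fun y => F y 2) x - pd 2 (fun y => F y 1) x,
      pd 2 (fun y => F y 0) x - pd 0 (fun y => F y 2) x,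
      pd 0 (fun y => F y 1) x - pd 1 (fun y => F y 0) x]

/-- The Jacobian matrix of a map `ℝ³ → ℝ³` at a point. -/
def jacobianMatrix (φ : E3 → E3) (x : E3) : Matrix (Fin 3) (Fin 3) ℝ :=
  Matrix.of fun i j => fderiv ℝ φ x (EuclideanSpace.single j 1) i

/-- Differentiation under the integral sign over a compact set, for an integrand whose
`t`-derivative is jointly continuous. -/
theorem hasDerivAt_setIntegral_of_continuous {X : Type*} [TopologicalSpace X]
    [MeasurableSpace X] [OpensMeasurableSpace X] {μ : Measure X}
    [IsFiniteMeasureOnCompacts μ] {F F' : ℝ → X → ℝ} {Ω : Set X}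
    (hΩc : IsCompact Ω) (hΩm : MeasurableSet Ω)
    (hF : ∀ t, Continuous (F t)) (hF' : Continuous (Function.uncurry F'))
    (h : ∀ t x, HasDerivAt (fun s => F s x) (F' t x) t) (t₀ : ℝ) :
    HasDerivAt (fun t => ∫ x in Ω, F t x ∂μ) (∫ x in Ω, F' t₀ x ∂μ) t₀ := by
  obtain ⟨K, hK⟩ := ((isCompact_closedBall t₀ 1).prod hΩc).exists_bound_of_continuousOn
    hF'.continuousOn
  have hint : ∀ G : X → ℝ, Continuous G → Integrable G (μ.restrict Ω) := fun G hG =>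
    hG.continuousOn.integrableOn_compact' hΩc hΩm
  have hc : Continuous (F' t₀) := hF'.comp (Continuous.prodMk_right t₀)
  refine (hasDerivAt_integral_of_dominated_loc_of_deriv_le (bound := fun _ => K)
    (Metric.closedBall_mem_nhds t₀ one_pos) (.of_forall fun t => (hint _ (hF t)).1)
    (hint _ (hF t₀)) (hint _ hc).1 ?_ (hint _ continuous_const)
    (.of_forall fun x t _ => h t x)).2
  filter_upwards [ae_restrict_mem hΩm] with x hx t ht
  exact hK (t, x) ⟨ht, hx⟩

/-- Jacobi's formula along a line of `3 × 3` matrices. -/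
theorem hasDerivAt_det_add_smul (A B : Matrix (Fin 3) (Fin 3) ℝ) (t : ℝ) :
    HasDerivAt (fun s : ℝ => (A + s • B).det) ((A + t • B).adjugate * B).trace t := by
  have expand : (fun s : ℝ => (A + s • B).det) = fun s =>
      A.det + s * (A.adjugate * B).trace + s ^ 2 * (B.adjugate * A).trace + s ^ 3 * B.det := by
    funext s
    simp only [Matrix.trace_fin_three, Matrix.mul_apply, Fin.sum_univ_three]
    simp [Matrix.det_fin_three, Matrix.adjugate_fin_three]
    ring
  rw [expand]
  have hd : HasDerivAt (fun s : ℝ => A.det + s * (A.adjugate * B).trace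
      + s ^ 2 * (B.adjugate * A).trace + s ^ 3 * B.det)
      (1 * (A.adjugate * B).trace + (2 * t) * (B.adjugate * A).trace + (3 * t ^ 2) * B.det) t := by
    have h2 : HasDerivAt (fun s : ℝ => s ^ 2) (2 * t) t := by simpa using hasDerivAt_pow 2 t
    have h3 : HasDerivAt (fun s : ℝ => s ^ 3) (3 * t ^ 2) t := by simpa using hasDerivAt_pow 3 t
    exact ((((hasDerivAt_id t).mul_const _).const_add _).add (h2.mul_const _)).add
      (h3.mul_const _)
  convert hd using 1
  simp only [Matrix.trace_fin_three, Matrix.mul_apply, Fin.sum_univ_three]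
  simp [Matrix.det_fin_three, Matrix.adjugate_fin_three]
  ring

theorem continuous_jacobianMatrix {φ : E3 → E3} (hφ : ContDiff ℝ 1 φ) :
    Continuous (jacobianMatrix φ) := by
  have h := hφ.continuous_fderiv one_ne_zero
  refine continuous_matrix fun i j => ?_
  exact (PiLp.continuous_apply 2 _ i).comp (h.clm_apply continuous_const)

theorem jacobianMatrix_add_smul {φ v : E3 → E3} {x : E3} (t : ℝ)
    (hφ : DifferentiableAt ℝ φ x) (hv : DifferentiableAt ℝ v x) :
    jacobianMatrix (fun y => φ y + t • v y) x
      = jacobianMatrix φ x + t • jacobianMatrix v x := by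
  ext i j
  have h := (hφ.hasFDerivAt.add (hv.hasFDerivAt.const_smul t)).fderiv
  have h' : fderiv ℝ (fun y => φ y + t • v y) x = fderiv ℝ φ x + t • fderiv ℝ v x := h
  simp [jacobianMatrix, h']

theorem jacobianMatrix_comp {φ ψ : E3 → E3} {x : E3}
    (hφ : DifferentiableAt ℝ φ (ψ x)) (hψ : DifferentiableAt ℝ ψ x) :
    jacobianMatrix (φ ∘ ψ) x = jacobianMatrix φ (ψ x) * jacobianMatrix ψ x := by
  ext i j
  have hsum : fderiv ℝ ψ x (EuclideanSpace.single j 1)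
      = ∑ k, (fderiv ℝ ψ x (EuclideanSpace.single j 1)) k • EuclideanSpace.single k (1 : ℝ) := by
    ext l
    simp [Finset.sum_apply, Pi.single_apply]
  simp only [jacobianMatrix, Matrix.of_apply, Matrix.mul_apply, fderiv_comp x hφ hψ,
    ContinuousLinearMap.comp_apply]
  conv_lhs => rw [hsum]
  simp [map_sum, mul_comm]

/-- Twice the axial vector of the antisymmetric part of a `3 × 3` matrix. -/
def axialVector (M : Matrix (Fin 3) (Fin 3) ℝ) : E3 :=
  !₂[M 2 1 - M 1 2, M 0 2 - M 2 0, M 1 0 - M 0 1]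

theorem axialVector_add_smul (M N : Matrix (Fin 3) (Fin 3) ℝ) (t : ℝ) :
    axialVector (M + t • N) = axialVector M + t • axialVector N := by
  ext i
  fin_cases i <;> simp [axialVector] <;> ring

theorem continuous_axialVector : Continuous axialVector := by
  refine (PiLp.continuous_toLp 2 _).comp (continuous_pi fun i => ?_)
  fin_cases i <;> simp <;> fun_prop

theorem pd_apply {F : E3 → E3} {x : E3} (hF : DifferentiableAt ℝ F x) (i j : Fin 3) :
    pd j (fun y => F y i) x = jacobianMatrix F x i j := by
  have h := ((EuclideanSpace.proj (𝕜 := ℝ) i).hasFDerivAt (x := F x)).comp x hF.hasFDerivAt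
  have h' : HasFDerivAt (fun y => F y i) _ x := h
  simp [pd, jacobianMatrix, h'.fderiv]

theorem curlE_eq_axialVector {F : E3 → E3} {x : E3} (hF : DifferentiableAt ℝ F x) :
    curlE F x = axialVector (jacobianMatrix F x) := by
  simp only [curlE, axialVector, pd_apply hF]
  rfl

/-- **First variation of the SSD functional in the perturbation direction `v`.**
The map `t ↦ SSD((φ_m + t•v) ∘ φ_o)` is differentiable at `t = 0` with derivative
`∫_Ω [P(x)·trace(adjugate(∇φ_m(φ_o x))·∇v(φ_o x))·det ∇φ_o(x) + Q(x)·∇×(v ∘ φ_o)(x)] dx`,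
where `P(x) = det ∇(φ_m ∘ φ_o)(x) − f_o(x)` and `Q(x) = ∇×(φ_m ∘ φ_o)(x) − g_o(x)`. -/
theorem ssd_hasDerivAt
    (φo φm v : E3 → E3) (fo : E3 → ℝ) (go : E3 → E3) (Ω : Set E3)
    (ho : ContDiff ℝ 1 φo) (hm : ContDiff ℝ 1 φm) (hv : ContDiff ℝ 1 v)
    (hfo : Continuous fo) (hgo : Continuous go)
    (hΩc : IsCompact Ω) (hΩm : MeasurableSet Ω) :
    HasDerivAt
      (fun t : ℝ => ∫ x in Ω,
        ((1 / 2) * ((jacobianMatrix ((fun y => φm y + t • v y) ∘ φo) x).det - fo x) ^ 2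
          + (1 / 2) * ‖curlE ((fun y => φm y + t • v y) ∘ φo) x - go x‖ ^ 2))
      (∫ x in Ω,
        (((jacobianMatrix (φm ∘ φo) x).det - fo x)
            * ((jacobianMatrix φm (φo x)).adjugate * jacobianMatrix v (φo x)).trace
            * (jacobianMatrix φo x).det
          + ⟪curlE (φm ∘ φo) x - go x, curlE (v ∘ φo) x⟫)) 0 := by
  have dO : Differentiable ℝ φo := ho.differentiable one_ne_zero
  have dM : Differentiable ℝ φm := hm.differentiable one_ne_zero
  have dV : Differentiable ℝ v := hv.differentiable one_ne_zero
  let A : E3 → Matrix (Fin 3) (Fin 3) ℝ := fun x => jacobianMatrix φm (φo x)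
  let B : E3 → Matrix (Fin 3) (Fin 3) ℝ := fun x => jacobianMatrix v (φo x)
  let C : E3 → Matrix (Fin 3) (Fin 3) ℝ := jacobianMatrix φo
  have hA : Continuous A := (continuous_jacobianMatrix hm).comp ho.continuous
  have hB : Continuous B := (continuous_jacobianMatrix hv).comp ho.continuous
  have hC : Continuous C := continuous_jacobianMatrix ho
  let p : E3 → E3 := fun x => axialVector (A x * C x)
  let q : E3 → E3 := fun x => axialVector (B x * C x)
  have hp : Continuous p := continuous_axialVector.comp (hA.matrix_mul hC)
  have hq : Continuous q := continuous_axialVector.comp (hB.matrix_mul hC)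
  have jacM : ∀ x, jacobianMatrix (φm ∘ φo) x = A x * C x := fun x =>
    jacobianMatrix_comp (dM _) (dO x)
  have curlM : ∀ x, curlE (φm ∘ φo) x = p x := fun x => by
    rw [curlE_eq_axialVector ((dM _).comp x (dO x)), jacM]
  have curlV : ∀ x, curlE (v ∘ φo) x = q x := fun x => by
    rw [curlE_eq_axialVector ((dV _).comp x (dO x)), jacobianMatrix_comp (dV _) (dO x)]
  have dT : ∀ t : ℝ, Differentiable ℝ (fun y => φm y + t • v y) := fun t =>
    dM.add (dV.const_smul t)
  have jacT : ∀ (t : ℝ) x, jacobianMatrix ((fun y => φm y + t • v y) ∘ φo) x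
      = (A x + t • B x) * C x := fun t x => by
    rw [jacobianMatrix_comp (dT t _) (dO x),
      jacobianMatrix_add_smul t (dM _) (dV _)]
  have curlT : ∀ (t : ℝ) x, curlE ((fun y => φm y + t • v y) ∘ φo) x
      = p x + t • q x := fun t x => by
    rw [curlE_eq_axialVector ((dT t _).comp x (dO x)), jacT,
      add_mul, smul_mul_assoc, axialVector_add_smul]
  simp only [jacT, curlT, jacM, curlM, curlV, Matrix.det_mul]
  have key := hasDerivAt_setIntegral_of_continuous (μ := volume) hΩc hΩm
    (F := fun t x => (1 / 2) * ((A x + t • B x).det * (C x).det - fo x) ^ 2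
      + (1 / 2) * ‖p x + t • q x - go x‖ ^ 2)
    (F' := fun t x => ((A x + t • B x).det * (C x).det - fo x)
      * ((A x + t • B x).adjugate * B x).trace * (C x).det + ⟪p x + t • q x - go x, q x⟫)
    (fun t => by fun_prop) (by unfold Function.uncurry; fun_prop) (fun t x => ?_) 0
  · simpa only [zero_smul, add_zero] using key
  · have hdet := (((hasDerivAt_det_add_smul (A x) (B x) t).mul_const (C x).det).sub_const
      (fo x)).pow 2
    have hcurl := ((((hasDerivAt_id t).smul_const (q x)).const_add (p x)).sub_const
      (go x)).norm_sq
    refine ((hdet.const_mul (1 / 2)).add (hcurl.const_mul (1 / 2))).congr_deriv ?_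
    simp
    ring
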